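/- arXiv:math/9412211 — 5 statements merged into one kernel-verified Lean document; each statement's English description precedes it below -/
import Mathlib

section
/- Let X be a real Banach space, (Ω,Σ,μ) a finite measure space, and m : Σ → X a finitely additive set function. If the net (m_π) of conditional expectations of m, directed by refinement of finite measurable partitions of Ω, converges to m in semivariation norm, then the range {m(B) : B ∈ Σ} is relatively norm-compact (totally bounded) in X. -/
open MeasureTheory

/-- A finite measurable partition of `Ω`: a finite collection of pairwise disjoint
measurable sets whose union is `Ω`. -/
structure FinPartition (Ω : Type*) [MeasurableSpace Ω] where
  parts : Finset (Set Ω)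
  measurableSet : ∀ A ∈ parts, MeasurableSet A
  disjoint : ∀ A ∈ parts, ∀ B ∈ parts, A ≠ B → Disjoint A B
  sUnion_eq : ⋃₀ (parts : Set (Set Ω)) = (Set.univ : Set Ω)

/-- `π'` refines `π` if every member of `π'` is contained in some member of `π`. -/
def FinPartition.Refines {Ω : Type*} [MeasurableSpace Ω] (π' π : FinPartition Ω) : Prop :=
  ∀ A ∈ π'.parts, ∃ B ∈ π.parts, A ⊆ B

/-- A finitely additive set function on the measurable sets. -/
def FinitelyAdditive {Ω : Type*} [MeasurableSpace Ω] {X : Type*} [AddCommMonoid X]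
    (m : Set Ω → X) : Prop :=
  ∀ A B : Set Ω, MeasurableSet A → MeasurableSet B → Disjoint A B → m (A ∪ B) = m A + m B

/-- A countably additive set function (vector measure) on the measurable sets. -/
def CountablyAdditive {Ω : Type*} [MeasurableSpace Ω] {X : Type*} [AddCommMonoid X]
    [TopologicalSpace X] (m : Set Ω → X) : Prop :=
  ∀ f : ℕ → Set Ω, (∀ n, MeasurableSet (f n)) → Pairwise (Function.onFun Disjoint f) →
    HasSum (fun n => m (f n)) (m (⋃ n, f n))

/-- The conditional expectation `m_π` of a set function `m` by the partition `π` and the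
measure `μ`:  `m_π(B) = ∑_{A ∈ π} (μ(A ∩ B)/μ(A)) • m(A)`, with the convention `0/0 = 0`
(so the terms with `μ(A) = 0` vanish). -/
noncomputable def partCondExp {Ω : Type*} [MeasurableSpace Ω] {X : Type*}
    [AddCommMonoid X] [Module ℝ X] (μ : Measure Ω) (m : Set Ω → X)
    (π : FinPartition Ω) (B : Set Ω) : X :=
  ∑ A ∈ π.parts, ((μ (A ∩ B)).toReal / (μ A).toReal) • m A

open scoped Classical in
/-- The partition of `Ω` into a measurable set and its complement. -/
noncomputable def FinPartition.pair {Ω : Type*} [MeasurableSpace Ω] (B : Set Ω)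
    (hB : MeasurableSet B) : FinPartition Ω where
  parts := {B, Bᶜ}
  measurableSet := by simp [hB, hB.compl]
  disjoint := by
    simp only [Finset.mem_insert, Finset.mem_singleton]
    rintro A (rfl | rfl) C (rfl | rfl) h
    · exact absurd rfl h
    · exact disjoint_compl_right
    · exact disjoint_compl_left
    · exact absurd rfl h
  sUnion_eq := by simp

theorem FinPartition.refines_refl {Ω : Type*} [MeasurableSpace Ω] (π : FinPartition Ω) :
    π.Refines π :=
  fun A hA => ⟨A, hA, subset_rfl⟩

/-- Evaluating on the partition `{B, Bᶜ}` bounds the value at `B` by the semivariation. -/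
theorem norm_lt_of_semivariation_lt {Ω X : Type*} [MeasurableSpace Ω]
    [NormedAddCommGroup X] [NormedSpace ℝ X] {n : Set Ω → X} {ε : ℝ}
    (h : ∀ (σ : FinPartition Ω) (c : Set Ω → ℝ), (∀ A ∈ σ.parts, |c A| ≤ 1) →
      ‖∑ A ∈ σ.parts, c A • n A‖ < ε)
    {B : Set Ω} (hB : MeasurableSet B) : ‖n B‖ < ε := by
  classical
  have key := h (.pair B hB) (fun A => if A = B then 1 else 0)
    (fun A _ => by split_ifs <;> simp)
  simpa [FinPartition.pair, ite_smul] using key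

/-- The conditional expectation by a finite partition has totally bounded range. -/
theorem totallyBounded_range_partCondExp {Ω X : Type*} [MeasurableSpace Ω]
    [NormedAddCommGroup X] [NormedSpace ℝ X] (μ : Measure Ω) [IsFiniteMeasure μ]
    (m : Set Ω → X) (π : FinPartition Ω) :
    TotallyBounded (Set.range (partCondExp μ m π)) := by
  have hK : IsCompact ((fun t : Set Ω → ℝ => ∑ A ∈ π.parts, t A • m A) ''
      Set.univ.pi fun _ => Set.Icc 0 1) :=
    (isCompact_univ_pi fun _ => isCompact_Icc).image (by fun_prop)
  refine hK.totallyBounded.subset ?_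
  rintro _ ⟨B, rfl⟩
  refine ⟨fun A => (μ (A ∩ B)).toReal / (μ A).toReal, fun A _ => ⟨by positivity, ?_⟩, rfl⟩
  exact div_le_one_of_le₀
    (ENNReal.toReal_mono (measure_ne_top μ A) (measure_mono Set.inter_subset_left))
    ENNReal.toReal_nonneg


/-- Lemma 1 of the paper, measure-theoretic content.
If the net `(m_π)` of conditional expectations of a finitely additive `m : Σ → X`,
directed by refinement of finite measurable partitions, converges to `m` in
semivariation norm, then the range `{m(B) : B ∈ Σ}` is totally bounded. -/
theorem statement0 {Ω X : Type*} [MeasurableSpace Ω]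
    [NormedAddCommGroup X] [NormedSpace ℝ X] [CompleteSpace X]
    (μ : Measure Ω) [IsFiniteMeasure μ] (m : Set Ω → X)
    (hm : FinitelyAdditive m)
    (hconv : ∀ ε : ℝ, 0 < ε → ∃ π₀ : FinPartition Ω, ∀ π : FinPartition Ω, π.Refines π₀ →
      ∀ (σ : FinPartition Ω) (c : Set Ω → ℝ), (∀ A ∈ σ.parts, |c A| ≤ 1) →
        ‖∑ A ∈ σ.parts, c A • (partCondExp μ m π A - m A)‖ < ε) :
    TotallyBounded {x : X | ∃ B : Set Ω, MeasurableSet B ∧ m B = x} := by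
  rw [Metric.totallyBounded_iff]
  intro ε hε
  obtain ⟨π, hπ⟩ := hconv (ε / 2) (half_pos hε)
  obtain ⟨t, ht, hcover⟩ := Metric.totallyBounded_iff.1
    (totallyBounded_range_partCondExp μ m π) (ε / 2) (half_pos hε)
  refine ⟨t, ht, ?_⟩
  rintro _ ⟨B, hB, rfl⟩
  obtain ⟨y, hy, hBy⟩ := Set.mem_iUnion₂.1 (hcover ⟨B, rfl⟩)
  have hdist : dist (m B) (partCondExp μ m π B) < ε / 2 := by
    rw [dist_comm, dist_eq_norm]
    exact norm_lt_of_semivariation_lt (n := fun A => partCondExp μ m π A - m A)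
      (hπ π π.refines_refl) hB
  refine Set.mem_iUnion₂.2 ⟨y, hy, ?_⟩
  rw [Metric.mem_ball] at hBy ⊢
  linarith [dist_triangle (m B) (partCondExp μ m π B) y]
end

section
/- For a real Banach space X the following are equivalent: (1) X has the Radon–Nikodým property, i.e., for every finite measure space (Ω,Σ,μ) and every countably additive vector measure m : Σ → X of bounded variation with m absolutely continuous with respect to μ, there exists a Bochner-integrable function f ∈ L¹(μ,X) such that m(B) = ∫_B f dμ for all B ∈ Σ; (2) for every finite measure space (Ω,Σ,μ) and every countably additive vector measure m : Σ → X of bounded variation with m absolutely continuous with respect to μ, the net (m_π) of conditional expectations of m, directed by refinement of finite measurable partitions, converges to m in variation norm. -/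
open MeasureTheory

universe u

namespace FinPartition

variable {Ω : Type*} [MeasurableSpace Ω]

/-- The partition `{B, Bᶜ}`. -/
noncomputable def pair_s3 (B : Set Ω) (hB : MeasurableSet B) : FinPartition Ω where
  parts := by classical exact {B, Bᶜ}
  measurableSet A hA := by
    simp only [Finset.mem_insert, Finset.mem_singleton] at hA
    rcases hA with rfl | rfl
    · exact hB
    · exact hB.compl
  disjoint A hA C hC h := by
    simp only [Finset.mem_insert, Finset.mem_singleton] at hA hC
    rcases hA with rfl | rfl <;> rcases hC with rfl | rfl
    · exact absurd rfl h
    · exact disjoint_compl_right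
    · exact disjoint_compl_left
    · exact absurd rfl h
  sUnion_eq := by simp

lemma mem_pair (B : Set Ω) (hB : MeasurableSet B) : B ∈ (pair_s3 B hB).parts := by
  simp [pair_s3]

/-- The partition of the domain of a simple function into its fibers. -/
noncomputable def fibers {Y : Type*} (g : SimpleFunc Ω Y) : FinPartition Ω where
  parts := by classical exact g.range.image fun x => g ⁻¹' {x}
  measurableSet A hA := by
    simp only [Finset.mem_image] at hA
    obtain ⟨x, -, rfl⟩ := hA
    exact g.measurableSet_fiber x
  disjoint A hA B hB h := by
    simp only [Finset.mem_image] at hA hB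
    obtain ⟨x, -, rfl⟩ := hA
    obtain ⟨y, -, rfl⟩ := hB
    refine Disjoint.preimage _ (Set.disjoint_singleton.2 ?_)
    rintro rfl
    exact h rfl
  sUnion_eq := by
    ext ω
    simp

lemma exists_eq_of_mem_fibers {Y : Type*} {g : SimpleFunc Ω Y} {A : Set Ω} (hA : A ∈ (fibers g).parts) :
    ∃ c, ∀ ω ∈ A, g ω = c := by
  simp only [fibers, Finset.mem_image] at hA
  obtain ⟨x, -, rfl⟩ := hA
  exact ⟨x, fun ω hω => hω⟩

lemma refines_rfl (π : FinPartition Ω) : π.Refines π := fun A hA => ⟨A, hA, subset_rfl⟩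

variable {X : Type*} [NormedAddCommGroup X] [NormedSpace ℝ X]

lemma sum_setIntegral (σ : FinPartition Ω) {μ : Measure Ω} {f : Ω → X} (hf : Integrable f μ) :
    ∑ A ∈ σ.parts, ∫ ω in A, f ω ∂μ = ∫ ω, f ω ∂μ := by
  rw [← integral_biUnion_finset σ.parts (s := fun A => A) σ.measurableSet
    (fun A hA B hB h => σ.disjoint A hA B hB h) fun A _ => hf.integrableOn]
  have h : (⋃ A ∈ σ.parts, A) = Set.univ := by
    rw [← σ.sUnion_eq, Set.sUnion_eq_biUnion]
    rfl
  rw [h, setIntegral_univ]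

lemma sum_setIntegral_inter (σ : FinPartition Ω) {μ : Measure Ω} {f : Ω → X}
    (hf : Integrable f μ) (B : Set Ω) :
    ∑ A ∈ σ.parts, ∫ ω in A ∩ B, f ω ∂μ = ∫ ω in B, f ω ∂μ := by
  rw [← σ.sum_setIntegral (hf.restrict (s := B))]
  exact Finset.sum_congr rfl fun A hA => by rw [Measure.restrict_restrict (σ.measurableSet A hA)]

lemma sum_measureReal_inter (σ : FinPartition Ω) (μ : Measure Ω) [IsFiniteMeasure μ] (A : Set Ω) :
    ∑ B ∈ σ.parts, (μ (A ∩ B)).toReal = (μ A).toReal := by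
  have h := σ.sum_setIntegral_inter (μ := μ) (integrable_const (1 : ℝ)) A
  simp only [setIntegral_const, smul_eq_mul, mul_one] at h
  simpa only [Set.inter_comm, Measure.real] using h

lemma sum_norm_setIntegral_le (σ : FinPartition Ω) {μ : Measure Ω} {f : Ω → X}
    (hf : Integrable f μ) :
    ∑ A ∈ σ.parts, ‖∫ ω in A, f ω ∂μ‖ ≤ ∫ ω, ‖f ω‖ ∂μ := by
  rw [← σ.sum_setIntegral hf.norm]
  exact Finset.sum_le_sum fun A _ => norm_integral_le_integral_norm _

lemma sum_fibers_norm_setIntegral [CompleteSpace X] (g : SimpleFunc Ω X) (μ : Measure Ω)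
    [IsFiniteMeasure μ] :
    ∑ A ∈ (fibers g).parts, ‖∫ ω in A, g ω ∂μ‖ = ∫ ω, ‖g ω‖ ∂μ := by
  rw [← (fibers g).sum_setIntegral (g.integrable_of_isFiniteMeasure (μ := μ)).norm]
  refine Finset.sum_congr rfl fun A hA => ?_
  obtain ⟨c, hc⟩ := exists_eq_of_mem_fibers hA
  have hA' := (fibers g).measurableSet A hA
  rw [setIntegral_congr_fun hA' hc,
    setIntegral_congr_fun hA' (g := fun _ => ‖c‖) fun ω hω => by simp [hc ω hω]]
  simp [norm_smul]

/-- The density of the conditional expectation `partCondExp μ m π` with respect to `μ`. -/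
noncomputable def density (μ : Measure Ω) (m : Set Ω → X) (π : FinPartition Ω) :
    SimpleFunc Ω X :=
  ∑ A ∈ π.parts, (SimpleFunc.const Ω ((μ A).toReal⁻¹ • m A)).restrict A

lemma density_apply (μ : Measure Ω) (m : Set Ω → X) (π : FinPartition Ω) (ω : Ω) :
    π.density μ m ω = ∑ A ∈ π.parts, A.indicator (fun _ => (μ A).toReal⁻¹ • m A) ω := by
  classical
  have h (s : Finset (Set Ω)) (F : Set Ω → SimpleFunc Ω X) :
      (∑ A ∈ s, F A) ω = ∑ A ∈ s, F A ω := by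
    induction s using Finset.induction_on with
    | empty => simp
    | insert a s ha ih => rw [Finset.sum_insert ha, Finset.sum_insert ha, SimpleFunc.add_apply, ih]
  rw [density, h]
  refine Finset.sum_congr rfl fun A hA => ?_
  rw [SimpleFunc.restrict_apply _ (π.measurableSet A hA)]
  rfl

lemma setIntegral_density [CompleteSpace X] (μ : Measure Ω) [IsFiniteMeasure μ] (m : Set Ω → X)
    (π : FinPartition Ω) (B : Set Ω) :
    ∫ ω in B, π.density μ m ω ∂μ = partCondExp μ m π B := by
  simp only [density_apply, partCondExp]
  rw [integral_finsetSum]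
  · refine Finset.sum_congr rfl fun A hA => ?_
    rw [integral_indicator (π.measurableSet A hA),
      Measure.restrict_restrict (π.measurableSet A hA), setIntegral_const, smul_smul,
      div_eq_mul_inv, Measure.real]
  · exact fun A hA => (integrable_const _).indicator (π.measurableSet A hA)

/-- Conditional expectation does not increase the variation of an indefinite integral. -/
lemma sum_norm_partCondExp_le {μ : Measure Ω} [IsFiniteMeasure μ] {h : Ω → X}
    (hh : Integrable h μ) (π σ : FinPartition Ω) :
    ∑ B ∈ σ.parts, ‖partCondExp μ (fun A => ∫ ω in A, h ω ∂μ) π B‖ ≤ ∫ ω, ‖h ω‖ ∂μ := by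
  calc ∑ B ∈ σ.parts, ‖partCondExp μ (fun A => ∫ ω in A, h ω ∂μ) π B‖
      ≤ ∑ B ∈ σ.parts, ∑ A ∈ π.parts,
          (μ (A ∩ B)).toReal / (μ A).toReal * ‖∫ ω in A, h ω ∂μ‖ := by
        refine Finset.sum_le_sum fun B _ => (norm_sum_le _ _).trans_eq ?_
        refine Finset.sum_congr rfl fun A _ => ?_
        rw [norm_smul, Real.norm_of_nonneg (by positivity)]
    _ = ∑ A ∈ π.parts, (μ A).toReal / (μ A).toReal * ‖∫ ω in A, h ω ∂μ‖ := by
        rw [Finset.sum_comm]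
        refine Finset.sum_congr rfl fun A _ => ?_
        rw [← Finset.sum_mul, ← Finset.sum_div, σ.sum_measureReal_inter μ A]
    _ ≤ ∑ A ∈ π.parts, ‖∫ ω in A, h ω ∂μ‖ :=
        Finset.sum_le_sum fun A _ =>
          mul_le_of_le_one_left (norm_nonneg _) (div_self_le_one _)
    _ ≤ ∫ ω, ‖h ω‖ ∂μ := π.sum_norm_setIntegral_le hh

/-- Conditioning the indefinite integral of a simple function on a partition that refines its
fibers changes nothing. -/
lemma partCondExp_simpleFunc [CompleteSpace X] {μ : Measure Ω} [IsFiniteMeasure μ]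
    (g : SimpleFunc Ω X) {π : FinPartition Ω} (hπ : π.Refines (fibers g)) {B : Set Ω}
    (hB : MeasurableSet B) :
    partCondExp μ (fun A => ∫ ω in A, g ω ∂μ) π B = ∫ ω in B, g ω ∂μ := by
  rw [← π.sum_setIntegral_inter g.integrable_of_isFiniteMeasure B]
  refine Finset.sum_congr rfl fun A hA => ?_
  obtain ⟨A', hA', hAA'⟩ := hπ A hA
  obtain ⟨c, hc⟩ := exists_eq_of_mem_fibers hA'
  have hmeas := π.measurableSet A hA
  beta_reduce
  rw [setIntegral_congr_fun hmeas fun ω hω => hc ω (hAA' hω),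
    setIntegral_congr_fun (hmeas.inter hB) fun ω hω => hc ω (hAA' hω.1),
    setIntegral_const, setIntegral_const, smul_smul, Measure.real, Measure.real]
  rcases eq_or_ne (μ A).toReal 0 with h | h
  · have h0 : (μ (A ∩ B)).toReal = 0 := by
      refine le_antisymm (h ▸ ?_) ENNReal.toReal_nonneg
      exact ENNReal.toReal_mono (measure_ne_top μ A) (measure_mono Set.inter_subset_left)
    simp [h, h0]
  · rw [div_mul_cancel₀ _ h]

/-- The conditional expectations of an indefinite Bochner integral converge in variation norm. -/
lemma exists_forall_refines_sum_norm_lt [CompleteSpace X] {μ : Measure Ω} [IsFiniteMeasure μ]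
    {m : Set Ω → X} {f : Ω → X} (hf : Integrable f μ)
    (hm : ∀ B, MeasurableSet B → m B = ∫ ω in B, f ω ∂μ) {ε : ℝ} (hε : 0 < ε) :
    ∃ π₀ : FinPartition Ω, ∀ π : FinPartition Ω, π.Refines π₀ →
      ∀ σ : FinPartition Ω, ∑ A ∈ σ.parts, ‖partCondExp μ m π A - m A‖ < ε := by
  obtain ⟨g, hg, -⟩ := (memLp_one_iff_integrable.2 hf).exists_simpleFunc_eLpNorm_sub_lt
    ENNReal.one_ne_top (ENNReal.ofReal_pos.2 (half_pos hε)).ne'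
  have hgi : Integrable g μ := g.integrable_of_isFiniteMeasure
  have hd : Integrable (fun ω => f ω - g ω) μ := hf.sub hgi
  have hlt : ∫ ω, ‖f ω - g ω‖ ∂μ < ε / 2 := by
    rw [eLpNorm_one_eq_lintegral_enorm] at hg
    rw [integral_norm_eq_lintegral_enorm hd.aestronglyMeasurable]
    exact ENNReal.toReal_lt_of_lt_ofReal hg
  refine ⟨fibers g, fun π hπ σ => ?_⟩
  have hsplit : ∀ B ∈ σ.parts, partCondExp μ m π B - m B =
      partCondExp μ (fun A => ∫ ω in A, (f ω - g ω) ∂μ) π B - ∫ ω in B, (f ω - g ω) ∂μ := by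
    intro B hB
    have h : partCondExp μ m π B = partCondExp μ (fun A => ∫ ω in A, (f ω - g ω) ∂μ) π B +
        partCondExp μ (fun A => ∫ ω in A, g ω ∂μ) π B := by
      simp only [partCondExp, ← Finset.sum_add_distrib, ← smul_add]
      refine Finset.sum_congr rfl fun A hA => ?_
      rw [hm A (π.measurableSet A hA), integral_sub hf.restrict hgi.restrict, sub_add_cancel]
    rw [h, partCondExp_simpleFunc g hπ (σ.measurableSet B hB), hm B (σ.measurableSet B hB),
      integral_sub hf.restrict hgi.restrict]
    abel
  calc ∑ B ∈ σ.parts, ‖partCondExp μ m π B - m B‖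
      ≤ ∑ B ∈ σ.parts, (‖partCondExp μ (fun A => ∫ ω in A, (f ω - g ω) ∂μ) π B‖ +
          ‖∫ ω in B, (f ω - g ω) ∂μ‖) :=
        Finset.sum_le_sum fun B hB => hsplit B hB ▸ norm_sub_le _ _
    _ ≤ ∫ ω, ‖f ω - g ω‖ ∂μ + ∫ ω, ‖f ω - g ω‖ ∂μ := by
        rw [Finset.sum_add_distrib]
        exact add_le_add (sum_norm_partCondExp_le hd π σ) (σ.sum_norm_setIntegral_le hd)
    _ < ε := by linarith

/-- If a set function is approximated in variation norm by its conditional expectations, then it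
is an indefinite Bochner integral. -/
lemma exists_integrable_of_forall_exists_sum_norm_lt [CompleteSpace X] {μ : Measure Ω}
    [IsFiniteMeasure μ] {m : Set Ω → X}
    (hm : ∀ ε : ℝ, 0 < ε → ∃ π : FinPartition Ω,
      ∀ σ : FinPartition Ω, ∑ A ∈ σ.parts, ‖partCondExp μ m π A - m A‖ < ε) :
    ∃ f : Ω → X, Integrable f μ ∧ ∀ B, MeasurableSet B → m B = ∫ ω in B, f ω ∂μ := by
  choose π hπ using fun n : ℕ => hm ((1 / 2 : ℝ) ^ n) (by positivity)
  let g (n : ℕ) : SimpleFunc Ω X := (π n).density μ m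
  have hg (n : ℕ) : Integrable (g n) μ := (g n).integrable_of_isFiniteMeasure
  let u (n : ℕ) : Lp X 1 μ := (hg n).toL1
  have hdist (n : ℕ) : dist (u n) (u (n + 1)) ≤ 2 * (1 / 2 : ℝ) ^ n := by
    have hnorm : dist (u n) (u (n + 1)) = ∫ ω, ‖(g n - g (n + 1)) ω‖ ∂μ := by
      rw [dist_eq_norm, ← Integrable.toL1_sub, L1.norm_of_fun_eq_integral_norm]
      rfl
    rw [hnorm, ← sum_fibers_norm_setIntegral]
    set σ := fibers (g n - g (n + 1))
    calc ∑ A ∈ σ.parts, ‖∫ ω in A, (g n - g (n + 1)) ω ∂μ‖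
        ≤ ∑ A ∈ σ.parts, (‖partCondExp μ m (π n) A - m A‖ +
            ‖partCondExp μ m (π (n + 1)) A - m A‖) := by
          refine Finset.sum_le_sum fun A _ => ?_
          have h : ∫ ω in A, (g n - g (n + 1)) ω ∂μ = (partCondExp μ m (π n) A - m A) -
              (partCondExp μ m (π (n + 1)) A - m A) := by
            simp only [SimpleFunc.coe_sub, Pi.sub_apply]
            rw [integral_sub (hg n).restrict (hg (n + 1)).restrict, setIntegral_density,
              setIntegral_density, sub_sub_sub_cancel_right]
          exact h ▸ norm_sub_le _ _
      _ ≤ (1 / 2 : ℝ) ^ n + (1 / 2 : ℝ) ^ (n + 1) := by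
          rw [Finset.sum_add_distrib]
          exact add_le_add (hπ n σ).le (hπ (n + 1) σ).le
      _ ≤ 2 * (1 / 2 : ℝ) ^ n := by
          have : (0 : ℝ) < (1 / 2) ^ n := by positivity
          rw [pow_succ]
          linarith
  obtain ⟨F, hF⟩ := cauchySeq_tendsto_of_complete
    (cauchySeq_of_le_geometric (1 / 2) 2 (by norm_num) hdist)
  refine ⟨F, L1.integrable_coeFn F, fun B hB => ?_⟩
  have hint : Filter.Tendsto (fun n => partCondExp μ m (π n) B) Filter.atTop
      (nhds (∫ ω in B, F ω ∂μ)) := by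
    refine (((continuous_setIntegral B).tendsto F).comp hF).congr fun n => ?_
    rw [← setIntegral_density]
    exact integral_congr_ae (ae_restrict_of_ae (hg n).coeFn_toL1)
  refine tendsto_nhds_unique (tendsto_iff_norm_sub_tendsto_zero.2 ?_) hint
  refine squeeze_zero (fun _ => norm_nonneg _) (fun n => ?_)
    (tendsto_pow_atTop_nhds_zero_of_lt_one (r := (1 / 2 : ℝ)) (by norm_num) (by norm_num))
  exact (Finset.single_le_sum (f := fun A => ‖partCondExp μ m (π n) A - m A‖)
    (fun A _ => norm_nonneg _) (mem_pair B hB)).trans (hπ n (pair_s3 B hB)).le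

end FinPartition

/-- Lemma 3 of the paper. A Banach space `X` has the Radon–Nikodým
property iff for every finite measure space and every countably additive `X`-valued
measure `m` of bounded variation with `m ≪ μ`, the net `(m_π)` of conditional
expectations converges to `m` in variation norm. -/
theorem statement3 {X : Type*} [NormedAddCommGroup X] [NormedSpace ℝ X] [CompleteSpace X] :
    (∀ (Ω : Type u) [MeasurableSpace Ω] (μ : Measure Ω) [IsFiniteMeasure μ]
      (m : Set Ω → X), CountablyAdditive m →
      (∃ C : ℝ, ∀ σ : FinPartition Ω, ∑ A ∈ σ.parts, ‖m A‖ ≤ C) →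
      (∀ A : Set Ω, MeasurableSet A → μ A = 0 → m A = 0) →
      ∃ f : Ω → X, Integrable f μ ∧
        ∀ B : Set Ω, MeasurableSet B → m B = ∫ ω in B, f ω ∂μ) ↔
    (∀ (Ω : Type u) [MeasurableSpace Ω] (μ : Measure Ω) [IsFiniteMeasure μ]
      (m : Set Ω → X), CountablyAdditive m →
      (∃ C : ℝ, ∀ σ : FinPartition Ω, ∑ A ∈ σ.parts, ‖m A‖ ≤ C) →
      (∀ A : Set Ω, MeasurableSet A → μ A = 0 → m A = 0) →
      ∀ ε : ℝ, 0 < ε → ∃ π₀ : FinPartition Ω, ∀ π : FinPartition Ω, π.Refines π₀ →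
        ∀ σ : FinPartition Ω, ∑ A ∈ σ.parts, ‖partCondExp μ m π A - m A‖ < ε) := by
  constructor
  · intro h Ω _ μ _ m hadd hbv hac ε hε
    obtain ⟨f, hf, hm⟩ := h Ω μ m hadd hbv hac
    exact FinPartition.exists_forall_refines_sum_norm_lt hf hm hε
  · intro h Ω _ μ _ m hadd hbv hac
    refine FinPartition.exists_integrable_of_forall_exists_sum_norm_lt fun ε hε => ?_
    obtain ⟨π₀, hπ₀⟩ := h Ω μ m hadd hbv hac ε hε
    exact ⟨π₀, hπ₀ π₀ π₀.refines_rfl⟩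
end

section
/- Let X be a real Banach space, (Ω,Σ,μ) a finite measure space, and m : Σ → X a countably additive vector measure of bounded variation with m absolutely continuous with respect to μ. Suppose the net (m_π) of conditional expectations, directed by refinement of finite measurable partitions, is Cauchy in variation norm, i.e., for every ε>0 there is a finite measurable partition π₀ such that |m_π − m_{π'}|(Ω) < ε whenever π and π' both refine π₀. Then there exists a Bochner-integrable function f ∈ L¹(μ,X) such that m(B) = ∫_B f dμ for all B ∈ Σ. -/
open MeasureTheory

open scoped Classical in
/-- The common refinement of two finite measurable partitions. -/
noncomputable def FinPartition.inter {Ω : Type*} [MeasurableSpace Ω] (π π' : FinPartition Ω) :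
    FinPartition Ω where
  parts := Finset.image₂ (· ∩ ·) π.parts π'.parts
  measurableSet := by
    intro A hA
    obtain ⟨B, hB, C, hC, rfl⟩ := Finset.mem_image₂.1 hA
    exact (π.measurableSet B hB).inter (π'.measurableSet C hC)
  disjoint := by
    intro A hA A' hA' hne
    obtain ⟨B, hB, C, hC, rfl⟩ := Finset.mem_image₂.1 hA
    obtain ⟨B', hB', C', hC', rfl⟩ := Finset.mem_image₂.1 hA'
    by_cases hBB : B = B'
    · have hCC : C ≠ C' := by
        rintro rfl
        exact hne (by rw [hBB])
      exact (π'.disjoint C hC C' hC' hCC).mono Set.inter_subset_right Set.inter_subset_right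
    · exact (π.disjoint B hB B' hB' hBB).mono Set.inter_subset_left Set.inter_subset_left
  sUnion_eq := by
    refine Set.eq_univ_of_forall fun x => ?_
    obtain ⟨B, hB, hxB⟩ : x ∈ ⋃₀ (π.parts : Set (Set Ω)) := π.sUnion_eq ▸ Set.mem_univ x
    obtain ⟨C, hC, hxC⟩ : x ∈ ⋃₀ (π'.parts : Set (Set Ω)) := π'.sUnion_eq ▸ Set.mem_univ x
    exact ⟨B ∩ C, Finset.mem_coe.2 (Finset.mem_image₂_of_mem hB hC), hxB, hxC⟩

theorem FinPartition.inter_refines_left {Ω : Type*} [MeasurableSpace Ω] (π π' : FinPartition Ω) :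
    (π.inter π').Refines π := by
  intro A hA
  obtain ⟨B, hB, C, -, rfl⟩ := Finset.mem_image₂.1 hA
  exact ⟨B, hB, Set.inter_subset_left⟩

theorem FinPartition.inter_refines_right {Ω : Type*} [MeasurableSpace Ω] (π π' : FinPartition Ω) :
    (π.inter π').Refines π' := by
  intro A hA
  obtain ⟨B, -, C, hC, rfl⟩ := Finset.mem_image₂.1 hA
  exact ⟨C, hC, Set.inter_subset_right⟩

open scoped Classical in
/-- The partition of `Ω` into the fibers of a simple function. -/
noncomputable def FinPartition.fibers_s4 {Ω X : Type*} [MeasurableSpace Ω] (g : SimpleFunc Ω X) :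
    FinPartition Ω where
  parts := g.range.image fun y => g ⁻¹' {y}
  measurableSet := by
    intro A hA
    obtain ⟨y, -, rfl⟩ := Finset.mem_image.1 hA
    exact g.measurableSet_fiber y
  disjoint := by
    intro A hA A' hA' hne
    obtain ⟨y, -, rfl⟩ := Finset.mem_image.1 hA
    obtain ⟨z, -, rfl⟩ := Finset.mem_image.1 hA'
    refine Disjoint.preimage g (Set.disjoint_singleton.2 ?_)
    rintro rfl
    exact hne rfl
  sUnion_eq := by
    refine Set.eq_univ_of_forall fun x => ⟨g ⁻¹' {g x}, ?_, rfl⟩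
    exact Finset.mem_coe.2 (Finset.mem_image_of_mem _ (g.mem_range_self x))

open scoped Classical in
/-- The partition of `Ω` into a measurable set and its complement. -/
noncomputable def FinPartition.compl {Ω : Type*} [MeasurableSpace Ω] (B : Set Ω)
    (hB : MeasurableSet B) : FinPartition Ω where
  parts := {B, Bᶜ}
  measurableSet := by
    intro A hA
    rcases Finset.mem_insert.1 hA with rfl | hA
    · exact hB
    · rw [Finset.mem_singleton.1 hA]
      exact hB.compl
  disjoint := by
    intro A hA A' hA' hne
    simp only [Finset.mem_insert, Finset.mem_singleton] at hA hA'
    rcases hA with rfl | rfl <;> rcases hA' with rfl | rfl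
    · exact absurd rfl hne
    · exact disjoint_compl_right
    · exact disjoint_compl_left
    · exact absurd rfl hne
  sUnion_eq := by simp

theorem integral_norm_eq_sum_fibers {Ω X : Type*} [MeasurableSpace Ω]
    [NormedAddCommGroup X] [NormedSpace ℝ X] [CompleteSpace X]
    (μ : Measure Ω) [IsFiniteMeasure μ] (g : SimpleFunc Ω X) :
    ∫ ω, ‖g ω‖ ∂μ = ∑ A ∈ (FinPartition.fibers_s4 g).parts, ‖∫ ω in A, g ω ∂μ‖ := by
  classical
  have hg : Integrable g μ := g.integrable_of_isFiniteMeasure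
  have hinj : Set.InjOn (fun y : X => g ⁻¹' {y}) g.range := by
    intro y hy z _ hyz
    obtain ⟨ω, rfl⟩ := SimpleFunc.mem_range.1 hy
    exact (Set.ext_iff.1 hyz ω).1 rfl
  have hnorm : ∫ ω, ‖g ω‖ ∂μ = (g.map norm).integral μ :=
    ((g.map norm).integral_eq_integral (g.map norm).integrable_of_isFiniteMeasure).symm
  rw [hnorm, SimpleFunc.map_integral g norm hg norm_zero]
  simp only [FinPartition.fibers_s4]
  rw [Finset.sum_image hinj]
  refine Finset.sum_congr rfl fun y _ => ?_
  rw [setIntegral_congr_fun (g := fun _ => y) (g.measurableSet_fiber y) fun ω hω => hω,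
    setIntegral_const, norm_smul, Real.norm_of_nonneg measureReal_nonneg, smul_eq_mul]

theorem exists_simpleFunc_setIntegral_eq_partCondExp {Ω X : Type*} [MeasurableSpace Ω]
    [NormedAddCommGroup X] [NormedSpace ℝ X] [CompleteSpace X]
    (μ : Measure Ω) [IsFiniteMeasure μ] (m : Set Ω → X) (π : FinPartition Ω) :
    ∃ g : SimpleFunc Ω X, ∀ B, MeasurableSet B → ∫ ω in B, g ω ∂μ = partCondExp μ m π B := by
  classical
  suffices h : ∀ S : Finset (Set Ω), (∀ A ∈ S, MeasurableSet A) →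
      ∃ g : SimpleFunc Ω X, ∀ B, MeasurableSet B →
        ∫ ω in B, g ω ∂μ = ∑ A ∈ S, ((μ (A ∩ B)).toReal / (μ A).toReal) • m A from
    h π.parts π.measurableSet
  intro S
  induction S using Finset.induction_on with
  | empty => exact fun _ => ⟨0, fun B _ => by simp⟩
  | insert A S hAS ih =>
    intro hS
    obtain ⟨g, hg⟩ := ih fun A' hA' => hS A' (Finset.mem_insert_of_mem hA')
    have hA := hS A (Finset.mem_insert_self A S)
    set c : X := (μ A).toReal⁻¹ • m A with hc
    refine ⟨(SimpleFunc.const Ω c).restrict A + g, fun B hB => ?_⟩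
    rw [Finset.sum_insert hAS, ← hg B hB, SimpleFunc.coe_add]
    simp only [Pi.add_apply]
    rw [integral_add (SimpleFunc.integrable_of_isFiniteMeasure _)
      (SimpleFunc.integrable_of_isFiniteMeasure _), SimpleFunc.coe_restrict _ hA,
      integral_indicator hA, Measure.restrict_restrict hA]
    simp only [SimpleFunc.coe_const, Function.const_apply]
    rw [setIntegral_const, hc, smul_smul, div_eq_mul_inv, Measure.real]

theorem sum_partition_inter_eq {Ω X : Type*} [MeasurableSpace Ω]
    [NormedAddCommGroup X] {m : Set Ω → X}
    (hca : CountablyAdditive m) (hempty : m ∅ = 0) (π : FinPartition Ω) {B : Set Ω}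
    (hB : MeasurableSet B) : ∑ A ∈ π.parts, m (A ∩ B) = m B := by
  classical
  let v : VectorMeasure Ω X :=
    { measureOf' := fun A => if MeasurableSet A then m A else 0
      empty' := by simp [hempty]
      not_measurable' := fun A hA => if_neg hA
      m_iUnion' := fun f hf hd => by
        simpa [hf, MeasurableSet.iUnion hf] using hca f hf hd }
  have hv : ∀ A, MeasurableSet A → v A = m A := fun A hA => if_pos hA
  have hmeas : ∀ A ∈ π.parts, MeasurableSet (A ∩ B) :=
    fun A hA => (π.measurableSet A hA).inter hB
  have hunion : ⋃ A ∈ π.parts, A ∩ B = B := by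
    have h : ⋃ A ∈ π.parts, A = Set.univ := by
      rw [← π.sUnion_eq, Set.sUnion_eq_biUnion]
      rfl
    rw [← Set.iUnion₂_inter, h, Set.univ_inter]
  have key := v.of_biUnion_finset (s := π.parts) (f := fun A => A ∩ B)
    (fun A hA A' hA' hne => (π.disjoint A hA A' hA' hne).mono Set.inter_subset_left
      Set.inter_subset_left) hmeas
  rw [hunion, hv B hB] at key
  rw [key]
  exact Finset.sum_congr rfl fun A hA => (hv _ (hmeas A hA)).symm

theorem partCondExp_eq_of_refines_compl {Ω X : Type*} [MeasurableSpace Ω]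
    [NormedAddCommGroup X] [NormedSpace ℝ X]
    (μ : Measure Ω) [IsFiniteMeasure μ] {m : Set Ω → X} (hca : CountablyAdditive m)
    (hac : ∀ A : Set Ω, MeasurableSet A → μ A = 0 → m A = 0) {π : FinPartition Ω} {B : Set Ω}
    (hB : MeasurableSet B) (hπ : π.Refines (FinPartition.compl B hB)) :
    partCondExp μ m π B = m B := by
  have hempty : m ∅ = 0 := hac ∅ MeasurableSet.empty measure_empty
  rw [← sum_partition_inter_eq hca hempty π hB]
  refine Finset.sum_congr rfl fun A hA => ?_
  obtain ⟨C, hC, hAC⟩ := hπ A hA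
  simp only [FinPartition.compl, Finset.mem_insert, Finset.mem_singleton] at hC
  rcases hC with rfl | rfl
  · rw [Set.inter_eq_left.2 hAC]
    by_cases h0 : μ A = 0
    · simp [hac A (π.measurableSet A hA) h0]
    · rw [div_self (ENNReal.toReal_ne_zero.2 ⟨h0, measure_ne_top μ A⟩), one_smul]
  · rw [(disjoint_compl_left.mono_left hAC).inter_eq, measure_empty, hempty]
    simp

/-- core of the implication (2) ⇒ (1) in Lemma 3.
If `m : Σ → X` is countably additive, of bounded variation, `m ≪ μ`, and the net `(m_π)` of
conditional expectations is Cauchy in variation norm, then `m` has a Bochner-integrable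
Radon–Nikodým derivative with respect to `μ`. -/
theorem statement4 {Ω X : Type*} [MeasurableSpace Ω]
    [NormedAddCommGroup X] [NormedSpace ℝ X] [CompleteSpace X]
    (μ : Measure Ω) [IsFiniteMeasure μ] (m : Set Ω → X)
    (hca : CountablyAdditive m)
    (hbv : ∃ C : ℝ, ∀ σ : FinPartition Ω, ∑ A ∈ σ.parts, ‖m A‖ ≤ C)
    (hac : ∀ A : Set Ω, MeasurableSet A → μ A = 0 → m A = 0)
    (hcauchy : ∀ ε : ℝ, 0 < ε → ∃ π₀ : FinPartition Ω,
      ∀ π π' : FinPartition Ω, π.Refines π₀ → π'.Refines π₀ →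
        ∀ σ : FinPartition Ω,
          ∑ A ∈ σ.parts, ‖partCondExp μ m π A - partCondExp μ m π' A‖ < ε) :
    ∃ f : Ω → X, Integrable f μ ∧
      ∀ B : Set Ω, MeasurableSet B → m B = ∫ ω in B, f ω ∂μ := by
  choose g hg using exists_simpleFunc_setIntegral_eq_partCondExp μ m
  have hgi : ∀ π, Integrable (g π) μ := fun π => (g π).integrable_of_isFiniteMeasure
  let F : FinPartition Ω → (Ω →₁[μ] X) := fun π => (hgi π).toL1 (g π)
  have hdist : ∀ π π' : FinPartition Ω, ∀ ε : ℝ,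
      (∀ σ : FinPartition Ω,
        ∑ A ∈ σ.parts, ‖partCondExp μ m π A - partCondExp μ m π' A‖ < ε) →
      dist (F π) (F π') < ε := by
    intro π π' ε h
    have hF : dist (F π) (F π') = ∫ ω, ‖(g π - g π') ω‖ ∂μ := by
      rw [dist_eq_norm, ← Integrable.toL1_sub, L1.norm_of_fun_eq_integral_norm]
      rfl
    rw [hF, integral_norm_eq_sum_fibers μ (g π - g π')]
    refine lt_of_eq_of_lt (Finset.sum_congr rfl fun A hA => ?_)
      (h (FinPartition.fibers_s4 (g π - g π')))
    have hA' := (FinPartition.fibers_s4 (g π - g π')).measurableSet A hA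
    rw [← hg π A hA', ← hg π' A hA',
      ← integral_sub (hgi π).integrableOn (hgi π').integrableOn]
    rfl
  choose p hp using fun n : ℕ => hcauchy (1 / ((n : ℝ) + 1)) Nat.one_div_pos_of_nat
  have hlim : Filter.Tendsto (fun n : ℕ => 1 / ((n : ℝ) + 1)) Filter.atTop (nhds 0) :=
    tendsto_one_div_add_atTop_nhds_zero_nat
  have hcs : CauchySeq fun n => F (p n) := by
    refine cauchySeq_of_le_tendsto_0 (fun n : ℕ => 1 / ((n : ℝ) + 1) + 1 / ((n : ℝ) + 1))
      (fun i j N hi hj => ?_) (by simpa using hlim.add hlim)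
    have h₁ := hdist _ _ _ (hp i (p i) ((p i).inter (p j)) (p i).refines_refl
      ((p i).inter_refines_left (p j)))
    have h₂ := hdist _ _ _ (hp j ((p i).inter (p j)) (p j) ((p i).inter_refines_right (p j))
      (p j).refines_refl)
    exact (dist_triangle _ (F ((p i).inter (p j))) _).trans (add_le_add
      (h₁.le.trans (Nat.one_div_le_one_div hi)) (h₂.le.trans (Nat.one_div_le_one_div hj)))
  obtain ⟨f, hf⟩ := cauchySeq_tendsto_of_complete hcs
  refine ⟨f, L1.integrable_coeFn f, fun B hB => ?_⟩
  have h₁ : Filter.Tendsto (fun n => partCondExp μ m (p n) B) Filter.atTop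
      (nhds (∫ ω in B, f ω ∂μ)) := by
    refine (((continuous_setIntegral B).tendsto f).comp hf).congr fun n => ?_
    rw [← hg (p n) B hB]
    exact integral_congr_ae (ae_restrict_of_ae (hgi (p n)).coeFn_toL1)
  have h₂ : Filter.Tendsto (fun n => partCondExp μ m (p n) B) Filter.atTop (nhds (m B)) := by
    refine tendsto_iff_norm_sub_tendsto_zero.2
      (squeeze_zero (fun _ => norm_nonneg _) (fun n => ?_) hlim)
    have h := hp n (p n) ((p n).inter (FinPartition.compl B hB)) (p n).refines_refl
      ((p n).inter_refines_left _) (FinPartition.compl B hB)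
    rw [← partCondExp_eq_of_refines_compl μ hca hac hB
      ((p n).inter_refines_right (FinPartition.compl B hB))]
    refine le_trans ?_ h.le
    exact Finset.single_le_sum (f := fun A => ‖partCondExp μ m (p n) A -
      partCondExp μ m ((p n).inter (FinPartition.compl B hB)) A‖)
      (fun _ _ => norm_nonneg _) (by simp [FinPartition.compl])
  exact tendsto_nhds_unique h₂ h₁
end

section
/- Let λ denote Lebesgue measure on [0,1] and let C([0,1],ℝ) carry the supremum norm. The bounded linear operator S : C([0,1],ℝ) → (C([0,1],ℝ) →L ℝ) defined by (S f)(g) = ∫₀¹ f(t) g(t) dλ(t) (taking values in the continuous dual of C([0,1],ℝ) with the operator norm) is not a compact operator. -/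
open MeasureTheory

/-- The cosine `t ↦ cos (k π t)` as a continuous function on the unit interval. -/
noncomputable def unitIntervalCos (k : ℤ) : C(unitInterval, ℝ) where
  toFun t := Real.cos (k * Real.pi * t)
  continuous_toFun := by fun_prop

lemma norm_unitIntervalCos_le_one (k : ℤ) : ‖unitIntervalCos k‖ ≤ 1 :=
  (ContinuousMap.norm_le _ zero_le_one).2 fun _ => Real.abs_cos_le_one _

lemma integral_unitIntervalCos (k : ℤ) (hk : k ≠ 0) :
    ∫ t, unitIntervalCos k t ∂(volume : Measure unitInterval) = 0 := by
  have hc : (k * Real.pi : ℝ) ≠ 0 :=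
    mul_ne_zero (Int.cast_ne_zero.2 hk) Real.pi_ne_zero
  calc ∫ t, unitIntervalCos k t ∂(volume : Measure unitInterval)
      = ∫ t in Set.Icc (0 : ℝ) 1, Real.cos (k * Real.pi * t) :=
        integral_subtype_comap measurableSet_Icc fun t : ℝ => Real.cos (k * Real.pi * t)
    _ = ∫ t in (0 : ℝ)..1, Real.cos (k * Real.pi * t) := by
        rw [integral_Icc_eq_integral_Ioc, intervalIntegral.integral_of_le zero_le_one]
    _ = 0 := by
        rw [intervalIntegral.integral_comp_mul_left _ hc]
        simp [Real.sin_int_mul_pi]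

lemma unitIntervalCos_mul (a b : ℤ) (t : unitInterval) :
    unitIntervalCos a t * unitIntervalCos b t =
      (unitIntervalCos (a - b) t + unitIntervalCos (a + b) t) / 2 := by
  simp only [unitIntervalCos, ContinuousMap.coe_mk, Int.cast_sub, Int.cast_add, sub_mul, add_mul,
    Real.cos_sub, Real.cos_add]
  ring

lemma integral_unitIntervalCos_mul (a b : ℤ) :
    ∫ t, unitIntervalCos a t * unitIntervalCos b t ∂(volume : Measure unitInterval) =
      ((∫ t, unitIntervalCos (a - b) t) + ∫ t, unitIntervalCos (a + b) t) / 2 := by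
  have hint (k : ℤ) : Integrable (unitIntervalCos k) (volume : Measure unitInterval) :=
    (unitIntervalCos k).continuous.integrable_of_hasCompactSupport
      (HasCompactSupport.of_compactSpace _)
  simp_rw [unitIntervalCos_mul]
  rw [integral_div, integral_add (hint _) (hint _)]

lemma integral_unitIntervalCos_mul_of_ne {m n : ℕ} (h : m ≠ n) :
    ∫ t, unitIntervalCos (m + 1) t * unitIntervalCos (n + 1) t
      ∂(volume : Measure unitInterval) = 0 := by
  rw [integral_unitIntervalCos_mul, integral_unitIntervalCos _ (by lia),
    integral_unitIntervalCos _ (by lia)]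
  simp

lemma integral_unitIntervalCos_mul_self (n : ℕ) :
    ∫ t, unitIntervalCos (n + 1) t * unitIntervalCos (n + 1) t
      ∂(volume : Measure unitInterval) = 1 / 2 := by
  rw [integral_unitIntervalCos_mul, integral_unitIntervalCos (_ + _) (by lia)]
  simp [unitIntervalCos]

lemma not_isCompact_of_separated_seq {X : Type*} [PseudoMetricSpace X] {s : Set X} {ε : ℝ}
    (hε : 0 < ε) (x : ℕ → X) (hx : ∀ n, x n ∈ s)
    (hsep : ∀ m n, m ≠ n → ε ≤ dist (x m) (x n)) : ¬ IsCompact s := by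
  intro hs
  obtain ⟨_, _, φ, hφ, hlim⟩ := hs.tendsto_subseq hx
  obtain ⟨N, hN⟩ := Metric.cauchySeq_iff.1 hlim.cauchySeq ε hε
  exact (hN (N + 1) (Nat.le_succ N) N le_rfl).not_ge
    (hsep _ _ (hφ.injective.ne (Nat.succ_ne_self N)))

lemma apply_sub_apply_le_dist {E : Type*} [SeminormedAddCommGroup E] [NormedSpace ℝ E]
    (φ ψ : E →L[ℝ] ℝ) {x : E} (hx : ‖x‖ ≤ 1) : φ x - ψ x ≤ dist φ ψ :=
  calc φ x - ψ x = (φ - ψ) x := rfl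
    _ ≤ ‖φ - ψ‖ * ‖x‖ := (le_abs_self _).trans ((φ - ψ).le_opNorm x)
    _ ≤ ‖φ - ψ‖ := mul_le_of_le_one_right (norm_nonneg _) hx
    _ = dist φ ψ := (dist_eq_norm φ ψ).symm

/-- Example 7 of the paper. The bounded linear operator
`S : C([0,1],ℝ) → C([0,1],ℝ)*`, `(S f)(g) = ∫₀¹ f(t) g(t) dλ(t)` (with `λ` Lebesgue
measure on `[0,1]`), is not a compact operator. -/
theorem statement9
    (S : C(unitInterval, ℝ) →L[ℝ] (C(unitInterval, ℝ) →L[ℝ] ℝ))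
    (hS : ∀ f g : C(unitInterval, ℝ),
      S f g = ∫ t, f t * g t ∂(volume : Measure unitInterval)) :
    ¬ IsCompact (closure (S '' Metric.closedBall 0 1)) := by
  refine not_isCompact_of_separated_seq one_half_pos
    (fun n : ℕ => S (unitIntervalCos (n + 1))) (fun n => subset_closure
      ⟨_, mem_closedBall_zero_iff.2 (norm_unitIntervalCos_le_one _), rfl⟩) fun m n h => ?_
  have hdist := apply_sub_apply_le_dist (S (unitIntervalCos (m + 1)))
    (S (unitIntervalCos (n + 1))) (norm_unitIntervalCos_le_one (m + 1))
  rwa [hS, hS, integral_unitIntervalCos_mul_self, integral_unitIntervalCos_mul_of_ne h.symm,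
    sub_zero] at hdist
end

section
/- Let λ denote Lebesgue measure on [0,1]. For n ≥ 1 let A_n = ⋃_{i=1}^{2^{n-1}} [(2i−2)/2ⁿ, (2i−1)/2ⁿ) be the union of the odd-indexed dyadic intervals of level n. Then for all integers 1 ≤ k < n, the continuous linear functional on C([0,1],ℝ) given by g ↦ ∫_{A_n} g dλ − ∫_{A_k} g dλ has operator norm at least 1/2. -/
open MeasureTheory

/-- The union `A_n = ⋃_{i=1}^{2^{n-1}} [(2i−2)/2ⁿ, (2i−1)/2ⁿ)` of the odd-indexed dyadic
intervals of level `n`, as a subset of `ℝ`. -/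
def oddDyadicUnion (n : ℕ) : Set ℝ :=
  ⋃ i ∈ Finset.Icc (1 : ℕ) (2 ^ (n - 1)),
    Set.Ico ((2 * (i : ℝ) - 2) / 2 ^ n) ((2 * (i : ℝ) - 1) / 2 ^ n)

/-- The `n`-th Rademacher function, extended to `ℝ` with period `1` (for `n ≥ 1`). -/
noncomputable def rademacher (n : ℕ) (x : ℝ) : ℝ :=
  if Even ⌊2 ^ n * x⌋ then 1 else -1

theorem measurable_rademacher (n : ℕ) : Measurable (rademacher n) := by
  refine Measurable.ite ?_ measurable_const measurable_const
  exact (Int.measurable_floor.comp (measurable_const_mul ((2 : ℝ) ^ n)))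
    (MeasurableSet.of_discrete (s := {m : ℤ | Even m}))

theorem abs_rademacher (n : ℕ) (x : ℝ) : |rademacher n x| = 1 := by
  unfold rademacher
  split_ifs <;> simp

theorem rademacher_mul_self (n : ℕ) (x : ℝ) : rademacher n x * rademacher n x = 1 := by
  rw [← abs_mul_abs_self, abs_rademacher, one_mul]

theorem rademacher_add_inv_two_pow (k : ℕ) (x : ℝ) :
    rademacher k (x + (2 ^ k)⁻¹) = -rademacher k x := by
  have h : (2 : ℝ) ^ k * (x + (2 ^ k)⁻¹) = 2 ^ k * x + 1 := by field_simp
  simp only [rademacher, h, Int.floor_add_one, Int.even_add_one]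
  split_ifs <;> simp_all

theorem rademacher_periodic {n k : ℕ} (hkn : k < n) :
    Function.Periodic (rademacher n) (2 ^ k)⁻¹ := by
  intro x
  obtain ⟨m, rfl⟩ := Nat.exists_eq_add_of_lt hkn
  have h : (2 : ℝ) ^ (k + m + 1) * (x + (2 ^ k)⁻¹) =
      2 ^ (k + m + 1) * x + ((2 * 2 ^ m : ℤ) : ℝ) := by
    push_cast
    field_simp
    ring
  simp only [rademacher, h, Int.floor_add_intCast, Int.even_add, even_two_mul, iff_true]

theorem integral_rademacher_mul_rademacher {n k : ℕ} (hk : 1 ≤ k) (hkn : k < n) :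
    ∫ x in (0 : ℝ)..1, rademacher n x * rademacher k x = 0 := by
  have hper : Function.Periodic (fun x ↦ rademacher n x * rademacher k x) 1 := by
    intro x
    have hn := rademacher_periodic (show 0 < n by omega) x
    have hk := rademacher_periodic (show 0 < k by omega) x
    simp only [pow_zero, inv_one] at hn hk
    simp only [hn, hk]
  have hshift := hper.intervalIntegral_add_eq (2 ^ k)⁻¹ 0
  rw [zero_add, add_comm _ (1 : ℝ)] at hshift
  have hneg := intervalIntegral.integral_comp_add_right (a := 0) (b := 1)
    (fun x ↦ rademacher n x * rademacher k x) (2 ^ k)⁻¹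
  simp only [rademacher_periodic hkn _, rademacher_add_inv_two_pow, mul_neg,
    intervalIntegral.integral_neg, zero_add] at hneg
  linarith

theorem mem_oddDyadicUnion_iff {n : ℕ} (hn : 1 ≤ n) {x : ℝ} (h0 : 0 ≤ x) (h1 : x < 1) :
    x ∈ oddDyadicUnion n ↔ Even ⌊2 ^ n * x⌋ := by
  have hpos : (0 : ℝ) < 2 ^ n := by positivity
  simp only [oddDyadicUnion, Set.mem_iUnion, Finset.mem_Icc, Set.mem_Ico, exists_prop,
    div_le_iff₀ hpos, lt_div_iff₀ hpos]
  constructor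
  · rintro ⟨i, -, hl, hr⟩
    have : ⌊2 ^ n * x⌋ = 2 * ((i : ℤ) - 1) := by
      rw [Int.floor_eq_iff]
      push_cast
      constructor <;> linarith
    rw [this]
    exact even_two_mul _
  · rintro ⟨m, hm⟩
    have hm0 : 0 ≤ ⌊2 ^ n * x⌋ := Int.floor_nonneg.2 (by positivity)
    have hm1 : ⌊2 ^ n * x⌋ < 2 ^ n := by
      rw [Int.floor_lt]
      push_cast
      nlinarith
    obtain ⟨hl, hr⟩ := Int.floor_eq_iff.1 hm
    lift m to ℕ using by omega
    obtain ⟨n, rfl⟩ := Nat.exists_eq_add_of_le' hn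
    have hmn : (m : ℤ) < 2 ^ n := by have := pow_succ (2 : ℤ) n; omega
    refine ⟨m + 1, ⟨by omega, ?_⟩, ?_, ?_⟩
    · rw [Nat.add_sub_cancel]
      exact_mod_cast hmn
    all_goals push_cast at hl hr ⊢; linarith

theorem one_notMem_oddDyadicUnion {n : ℕ} (hn : 1 ≤ n) : (1 : ℝ) ∉ oddDyadicUnion n := by
  simp only [oddDyadicUnion, Set.mem_iUnion, Finset.mem_Icc, Set.mem_Ico, exists_prop, not_exists,
    not_and, not_lt]
  rintro i ⟨-, hi⟩ -
  have : (i : ℝ) ≤ 2 ^ (n - 1) := by exact_mod_cast hi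
  obtain ⟨n, rfl⟩ := Nat.exists_eq_add_of_le' hn
  rw [div_le_one (by positivity), pow_succ]
  rw [Nat.add_sub_cancel] at this
  linarith

theorem rademacher_one {n : ℕ} (hn : 1 ≤ n) : rademacher n 1 = 1 := by
  have h := rademacher_periodic (show 0 < n by omega) 0
  rw [pow_zero, inv_one, zero_add] at h
  rw [h]
  simp [rademacher]

theorem measurableSet_oddDyadicUnion (n : ℕ) : MeasurableSet (oddDyadicUnion n) :=
  Finset.measurableSet_biUnion _ fun _ _ ↦ measurableSet_Ico

theorem indicator_sub_indicator_oddDyadicUnion {n k : ℕ} (hn : 1 ≤ n) (hk : 1 ≤ k) {x : ℝ}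
    (hx : x ∈ Set.Icc (0 : ℝ) 1) :
    (oddDyadicUnion n).indicator 1 x - (oddDyadicUnion k).indicator 1 x =
      (rademacher n x - rademacher k x) / 2 := by
  obtain rfl | h1 := hx.2.eq_or_lt
  · simp [one_notMem_oddDyadicUnion, rademacher_one, hn, hk]
  · classical
    simp only [Set.indicator_apply, mem_oddDyadicUnion_iff hn hx.1 h1,
      mem_oddDyadicUnion_iff hk hx.1 h1, rademacher, Pi.one_apply]
    split_ifs <;> norm_num

theorem integral_sq_rademacher_sub_rademacher {n k : ℕ} (hk : 1 ≤ k) (hkn : k < n) :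
    ∫ t : unitInterval, ((rademacher n t - rademacher k t) / 2) ^ 2 = 1 / 2 := by
  have hint : Integrable (fun x ↦ rademacher n x * rademacher k x)
      (volume.restrict (Set.Ioc (0 : ℝ) 1)) := by
    refine Integrable.of_bound
      ((measurable_rademacher n).mul (measurable_rademacher k)).aestronglyMeasurable 1 ?_
    exact ae_of_all _ fun x ↦ by simp [abs_rademacher]
  have hsq (x : ℝ) : ((rademacher n x - rademacher k x) / 2) ^ 2 =
      1 / 2 - 1 / 2 * (rademacher n x * rademacher k x) := by
    linear_combination (1 / 4) * rademacher_mul_self n x + (1 / 4) * rademacher_mul_self k x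
  have hzero := integral_rademacher_mul_rademacher hk hkn
  rw [intervalIntegral.integral_of_le zero_le_one] at hzero
  simp only [hsq]
  rw [unitInterval.measurePreserving_coe.integral_comp
      (MeasurableEmbedding.subtype_coe measurableSet_Icc)
      (fun x : ℝ ↦ 1 / 2 - 1 / 2 * (rademacher n x * rademacher k x)),
    integral_Icc_eq_integral_Ioc, integral_sub (integrable_const _) (hint.const_mul _),
    integral_const_mul, hzero]
  simp

/-- A continuous linear functional on `C(X, ℝ)` given by a density `f` with values in `[-1, 1]`
has norm at least `∫ f ^ 2`. -/
theorem integral_sq_le_norm_of_apply_eq_integral_mul {X : Type*} [TopologicalSpace X]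
    [CompactSpace X] [NormalSpace X] [MeasurableSpace X] [BorelSpace X] {μ : Measure X}
    [IsFiniteMeasure μ] [μ.WeaklyRegular] {f : X → ℝ} (hf : Measurable f)
    (hf1 : ∀ x, |f x| ≤ 1) (ψ : C(X, ℝ) →L[ℝ] ℝ) (hψ : ∀ g : C(X, ℝ), ψ g = ∫ x, f x * g x ∂μ) :
    ∫ x, f x ^ 2 ∂μ ≤ ‖ψ‖ := by
  refine le_of_forall_pos_le_add fun ε hε ↦ ?_
  have hfi : Integrable f μ := Integrable.of_bound hf.aestronglyMeasurable 1 (ae_of_all _ hf1)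
  obtain ⟨h, hh, hhi⟩ := hfi.exists_boundedContinuous_integral_sub_le hε
  let g : C(X, ℝ) := ⟨fun x ↦ max (-1) (min 1 (h x)), by fun_prop⟩
  have hg1 (x : X) : |g x| ≤ 1 :=
    abs_le.2 ⟨le_max_left _ _, max_le (by norm_num) (min_le_left _ _)⟩
  have hclamp (x : X) : |f x - g x| ≤ |f x - h x| := by
    obtain ⟨hl, hr⟩ := abs_le.1 (hf1 x)
    change |f x - max (-1) (min 1 (h x))| ≤ _
    grind
  have hgi : Integrable g μ :=
    Integrable.of_bound g.continuous.measurable.aestronglyMeasurable 1 (ae_of_all _ hg1)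
  have hfg : Integrable (fun x ↦ f x * g x) μ := hgi.bdd_mul hf.aestronglyMeasurable
    (ae_of_all _ hf1)
  calc ∫ x, f x ^ 2 ∂μ ≤ ∫ x, (f x * g x + ‖f x - h x‖) ∂μ := by
        refine integral_mono ?_ (hfg.add (hfi.sub hhi).norm) fun x ↦ ?_
        · simpa only [sq] using hfi.bdd_mul hf.aestronglyMeasurable (ae_of_all _ hf1)
        · have : f x * (f x - g x) ≤ |f x - h x| := by
            refine (le_abs_self _).trans ?_
            rw [abs_mul]
            exact (mul_le_of_le_one_left (abs_nonneg _) (hf1 x)).trans (hclamp x)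
          simp only [Real.norm_eq_abs]
          linarith
    _ = ψ g + ∫ x, ‖f x - h x‖ ∂μ := by
        rw [hψ]
        exact integral_add hfg (hfi.sub hhi).norm
    _ ≤ ‖ψ‖ + ε := by
        refine add_le_add ?_ hh
        refine (le_abs_self _).trans (ψ.unit_le_opNorm g ?_)
        exact (ContinuousMap.norm_le _ zero_le_one).2 hg1

/-- key computation in Example 7 of the paper. For `1 ≤ k < n`, the
continuous linear functional `g ↦ ∫_{A_n} g dλ − ∫_{A_k} g dλ` on `C([0,1],ℝ)` has
operator norm at least `1/2`, where `λ` is Lebesgue measure on `[0,1]`. -/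
theorem statement11
    (φ : Set unitInterval → (C(unitInterval, ℝ) →L[ℝ] ℝ))
    (hφ : ∀ (A : Set unitInterval) (g : C(unitInterval, ℝ)),
      φ A g = ∫ t in A, g t ∂(volume : Measure unitInterval))
    (n k : ℕ) (hk : 1 ≤ k) (hkn : k < n) :
    1 / 2 ≤ ‖φ (Subtype.val ⁻¹' oddDyadicUnion n) - φ (Subtype.val ⁻¹' oddDyadicUnion k)‖ := by
  have hn : 1 ≤ n := hk.trans hkn.le
  rw [← integral_sq_rademacher_sub_rademacher hk hkn]
  refine integral_sq_le_norm_of_apply_eq_integral_mul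
    (f := fun t : unitInterval ↦ (rademacher n t - rademacher k t) / 2) ?_ (fun t ↦ ?_) _ fun g ↦ ?_
  · exact (((measurable_rademacher n).comp measurable_subtype_coe).sub
      ((measurable_rademacher k).comp measurable_subtype_coe)).div_const 2
  · have h := abs_sub (rademacher n t) (rademacher k t)
    rw [abs_rademacher, abs_rademacher] at h
    rw [abs_div, abs_two]
    linarith
  · have hg : Integrable g (volume : Measure unitInterval) :=
      g.continuous.integrable_of_hasCompactSupport (HasCompactSupport.of_compactSpace _)
    have hA (m : ℕ) : MeasurableSet (Subtype.val ⁻¹' oddDyadicUnion m : Set unitInterval) :=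
      measurable_subtype_coe (measurableSet_oddDyadicUnion m)
    rw [sub_apply, hφ, hφ, ← integral_indicator (hA n),
      ← integral_indicator (hA k), ← integral_sub (hg.indicator (hA n)) (hg.indicator (hA k))]
    refine integral_congr_ae (ae_of_all _ fun t ↦ ?_)
    classical
    simp only [← indicator_sub_indicator_oddDyadicUnion hn hk t.2, Set.indicator_apply,
      Set.mem_preimage, Pi.one_apply]
    split_ifs <;> ring
end
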